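/- Let (Ω, 𝓕, 𝔽, P) satisfy the usual conditions, 0 < L < U constants, η a progressively measurable process with L ≤ η ≤ U (P ⊗ dt)-a.e., λ : [0,∞) × ℕ → [0,∞) measurable with L ≤ λ(·, x) ≤ U Lebesgue-a.e. for each x ∈ ℕ, and (E_k)_{k≥1} i.i.d. Exp(1) random variables independent of 𝓕_∞. For a sequence (γ_k)_{k∈ℕ} of measurable functions γ_k : [0,∞) → [L, U], define τ_0 := 0 and inductively τ_k := inf{t > τ_{k-1} : ∫_{τ_{k-1}}^t (η_s / γ_{k-1}(s)) λ(s, k−1) ds ≥ E_k}. Then there exists a sequence (γ_k)_{k∈ℕ} of measurable functions [0,∞) → [L, U], unique up to Lebesgue-a.e. equality, such that for every k ∈ ℕ and Lebesgue-a.e. t ≥ 0: γ_k(t) · E[1_{{τ_k < t}} exp(−∫_{τ_k}^t (η_s / γ_k(s)) λ(s, k) ds)] = E[η_t · 1_{{τ_k < t}} exp(−∫_{τ_k}^t (η_s / γ_k(s)) λ(s, k) ds)]. -/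

import Mathlib

open MeasureTheory ProbabilityTheory Filter Set
open scoped ENNReal Topology

noncomputable section

namespace InvMarkovJump

variable {Ω : Type*}

/-- `F` is a filtration (for times `t ≥ 0`) of sub-σ-algebras of `m0`. -/
def IsFiltration (m0 : MeasurableSpace Ω) (F : ℝ → MeasurableSpace Ω) : Prop :=
  (∀ s t : ℝ, 0 ≤ s → s ≤ t → F s ≤ F t) ∧ ∀ t : ℝ, F t ≤ m0

/-- The right-continuous regularization `(⋂_{s > t} F s)_{t ≥ 0}` of a filtration. -/
def rcReg (F : ℝ → MeasurableSpace Ω) : ℝ → MeasurableSpace Ω :=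
  fun t => ⨅ s ∈ Set.Ioi t, F s

/-- All sample paths of `M` are right-continuous (at every time `t ≥ 0`). -/
def RCPaths (M : ℝ → Ω → ℝ) : Prop :=
  ∀ ω, ∀ t : ℝ, 0 ≤ t → ContinuousWithinAt (fun s => M s ω) (Set.Ici t) t

/-- `M` is a martingale (for times `t ≥ 0`) with respect to the filtration `F`
under the measure `μ`: it is adapted, integrable, and `E[M_t | F_s] = M_s` a.s.
for all `0 ≤ s ≤ t`. -/
def IsMartingale {m0 : MeasurableSpace Ω} (μ : Measure Ω)
    (F : ℝ → MeasurableSpace Ω) (M : ℝ → Ω → ℝ) : Prop :=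
  (∀ t : ℝ, 0 ≤ t → Integrable (M t) μ) ∧
  (∀ t : ℝ, 0 ≤ t → Measurable[F t] (M t)) ∧
  ∀ s t : ℝ, 0 ≤ s → s ≤ t → μ[M t|F s] =ᵐ[μ] M s

/-- `F` is immersed in `G`: `F ⊆ G` and every `F`-martingale (with right-continuous
sample paths) is a `G`-martingale. -/
def Immersed {m0 : MeasurableSpace Ω} (μ : Measure Ω)
    (F G : ℝ → MeasurableSpace Ω) : Prop :=
  (∀ t : ℝ, 0 ≤ t → F t ≤ G t) ∧
  ∀ M : ℝ → Ω → ℝ, RCPaths M → IsMartingale μ F M → IsMartingale μ G M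

/-- The usual conditions: the filtration is right-continuous and `F 0` contains
all `μ`-null sets. -/
def UsualConditions {m0 : MeasurableSpace Ω} (μ : Measure Ω)
    (F : ℝ → MeasurableSpace Ω) : Prop :=
  IsFiltration m0 F ∧ (∀ t : ℝ, 0 ≤ t → F t = rcReg F t) ∧
    ∀ s : Set Ω, μ s = 0 → MeasurableSet[F 0] s

/-- `E` is `Exp(1)`-distributed: `P(E > x) = e^{-x}` for all `x ≥ 0`. -/
def IsExpOne {m0 : MeasurableSpace Ω} (μ : Measure Ω) (E : Ω → ℝ) : Prop :=
  Measurable E ∧ ∀ x : ℝ, 0 ≤ x → μ {ω | x < E ω} = ENNReal.ofReal (Real.exp (-x))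

/-- `F_∞ = ⋁_{t ≥ 0} F t`. -/
def Finfty (F : ℝ → MeasurableSpace Ω) : MeasurableSpace Ω :=
  ⨆ t ∈ Set.Ici (0:ℝ), F t

/-- The natural filtration `(σ(Y_s : 0 ≤ s ≤ t))_{t ≥ 0}` of a process `Y`. -/
def natFilt {β : Type*} [MeasurableSpace β] (Y : ℝ → Ω → β) : ℝ → MeasurableSpace Ω :=
  fun t => ⨆ s ∈ Set.Icc (0:ℝ) t, MeasurableSpace.comap (Y s) inferInstance

/-- Progressive measurability of a process `u` with respect to the filtration `F`:
for every `t ≥ 0`, `(s, ω) ↦ u s ω` on `[0, t] × Ω` is `B([0,t]) ⊗ F t`-measurable. -/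
def ProgMeas (F : ℝ → MeasurableSpace Ω) (u : ℝ → Ω → ℝ) : Prop :=
  ∀ t : ℝ, 0 ≤ t →
    Measurable[MeasurableSpace.prod inferInstance (F t)]
      (fun p : Set.Icc (0:ℝ) t × Ω => u p.1 p.2)

/-- The accumulated intensity on `(a, t]`. -/
def J (η : ℝ → Ω → ℝ) (l g : ℝ → ℝ) (a t : ℝ) (ω : Ω) : ℝ :=
  ∫ s in Set.Ioc a t, η s ω / g s * l s

/-- The denominator. -/
def Dn {m0 : MeasurableSpace Ω} (μ : Measure Ω) (η : ℝ → Ω → ℝ) (l : ℝ → ℝ) (τ : Ω → ℝ)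
    (g : ℝ → ℝ) (t : ℝ) : ℝ :=
  ∫ ω, (if τ ω < t then Real.exp (-J η l g (τ ω) t ω) else 0) ∂μ

/-- The numerator. -/
def Nn {m0 : MeasurableSpace Ω} (μ : Measure Ω) (η : ℝ → Ω → ℝ) (l : ℝ → ℝ) (τ : Ω → ℝ)
    (g : ℝ → ℝ) (t : ℝ) : ℝ :=
  ∫ ω, (if τ ω < t then η t ω * Real.exp (-J η l g (τ ω) t ω) else 0) ∂μ

/-- The fixed point map. -/
def Ph {m0 : MeasurableSpace Ω} (μ : Measure Ω) (L : ℝ) (η : ℝ → Ω → ℝ) (l : ℝ → ℝ) (τ : Ω → ℝ)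
    (g : ℝ → ℝ) (t : ℝ) : ℝ :=
  if 0 < t then Nn μ η l τ g t / Dn μ η l τ g t else L

/-- Measurable functions with values in `[L, U]`. -/
def InS (L U : ℝ) (g : ℝ → ℝ) : Prop := Measurable g ∧ ∀ t, L ≤ g t ∧ g t ≤ U

lemma InS.measurable_abs_sub {L U : ℝ} {g g' : ℝ → ℝ} (hg : InS L U g) (hg' : InS L U g') :
    Measurable fun s => |g s - g' s| := by
  have := hg.1; have := hg'.1
  exact (hg.1.sub hg'.1).abs

lemma InS.abs_sub_le {L U : ℝ} {g g' : ℝ → ℝ} (hg : InS L U g) (hg' : InS L U g') (s : ℝ) :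
    |g s - g' s| ≤ U - L := by
  have h1 := hg.2 s; have h2 := hg'.2 s
  rw [abs_le]; constructor <;> linarith

lemma integrableOn_of_bdd {f : ℝ → ℝ} (hf : Measurable f) {B : ℝ} (hB : ∀ s, |f s| ≤ B)
    (a t : ℝ) : IntegrableOn f (Set.Ioc a t) := by
  refine Measure.integrableOn_of_bounded (M := B) ?_ hf.aestronglyMeasurable ?_
  · simp
  · exact ae_of_all _ fun s => by simpa using hB s

lemma InS.integrableOn_abs_sub {L U : ℝ} {g g' : ℝ → ℝ} (hg : InS L U g) (hg' : InS L U g')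
    (a t : ℝ) : IntegrableOn (fun s => |g s - g' s|) (Set.Ioc a t) :=
  integrableOn_of_bdd (hg.measurable_abs_sub hg') (B := U - L)
    (fun s => by rw [abs_abs]; exact hg.abs_sub_le hg' s) a t

lemma picard_bound {M C T : ℝ} (hC : 0 ≤ C) (δ : ℕ → ℝ → ℝ)
    (hint : ∀ n t, IntegrableOn (δ n) (Set.Ioc 0 t)) (h0 : ∀ t, δ 0 t ≤ M)
    (hs : ∀ n t, 0 ≤ t → t ≤ T → δ (n + 1) t ≤ C * ∫ s in Set.Ioc 0 t, δ n s) :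
    ∀ n t, 0 ≤ t → t ≤ T → δ n t ≤ M * ((C * t) ^ n / n.factorial) := by
  intro n
  induction n with
  | zero => intro t _ _; simpa using h0 t
  | succ n ih =>
    intro t ht htT
    refine (hs n t ht htT).trans ?_
    have h1 : ∫ s in Set.Ioc 0 t, δ n s ≤
        ∫ s in Set.Ioc 0 t, M * ((C * s) ^ n / n.factorial) := by
      refine setIntegral_mono_on (hint n t) ?_ measurableSet_Ioc ?_
      · exact (Continuous.integrableOn_Ioc (by fun_prop))
      · intro s hs'
        exact ih s hs'.1.le (hs'.2.trans htT)
    have h2 : ∫ s in Set.Ioc 0 t, M * ((C * s) ^ n / n.factorial) =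
        M * (C ^ n * t ^ (n + 1) / (n + 1).factorial) := by
      rw [← intervalIntegral.integral_of_le ht]
      have : ∀ s : ℝ, M * ((C * s) ^ n / n.factorial) = (M * C ^ n / n.factorial) * s ^ n := by
        intro s; rw [mul_pow]; ring
      simp_rw [this]
      rw [intervalIntegral.integral_const_mul, integral_pow, Nat.factorial_succ]
      push_cast
      have := Nat.factorial_pos n
      have h3 : (n.factorial : ℝ) ≠ 0 := by positivity
      have h4 : (n : ℝ) + 1 ≠ 0 := by positivity
      field_simp
      simp
    calc C * ∫ s in Set.Ioc 0 t, δ n s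
        ≤ C * (M * (C ^ n * t ^ (n + 1) / (n + 1).factorial)) := by
          rw [← h2]; exact mul_le_mul_of_nonneg_left h1 hC
      _ = _ := by rw [mul_pow]; ring

/-- Abstract Volterra-type fixed point theorem. -/
lemma abstract_fp {L U : ℝ} (hLU : L ≤ U) (Φ : (ℝ → ℝ) → ℝ → ℝ)
    (hmap : ∀ g, InS L U g → InS L U (Φ g))
    (hneg : ∀ g g' t, t ≤ 0 → Φ g t = Φ g' t)
    (C : ℝ → ℝ) (hC : ∀ T, 0 ≤ C T)
    (hest : ∀ g g', InS L U g → InS L U g' → ∀ T t, 0 ≤ t → t ≤ T →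
      |Φ g t - Φ g' t| ≤ C T * ∫ s in Set.Ioc 0 t, |g s - g' s|) :
    (∃ g, InS L U g ∧ Φ g = g) ∧
      ∀ g g', InS L U g → InS L U g' → (∀ t, Φ g t = g t) → (∀ t, Φ g' t = g' t) → g = g' := by
  constructor
  · let γ : ℕ → ℝ → ℝ := fun n => Φ^[n] (fun _ => L)
    have hγS : ∀ n, InS L U (γ n) := by
      intro n
      induction n with
      | zero => exact ⟨measurable_const, fun t => ⟨le_rfl, hLU⟩⟩
      | succ n ih =>
        have : γ (n + 1) = Φ (γ n) := Function.iterate_succ_apply' _ _ _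
        rw [this]; exact hmap _ ih
    have hγs : ∀ n, γ (n + 1) = Φ (γ n) := fun n => Function.iterate_succ_apply' _ _ _
    have hb : ∀ T n t, 0 ≤ t → t ≤ T →
        |γ (n + 1) t - γ n t| ≤ (U - L) * ((C T * t) ^ n / n.factorial) := by
      intro T
      refine picard_bound (hC T) (fun n t => |γ (n + 1) t - γ n t|) ?_ ?_ ?_
      · intro n t; exact (hγS (n+1)).integrableOn_abs_sub (hγS n) 0 t
      · intro t; exact (hγS 1).abs_sub_le (hγS 0) t
      · intro n t ht htT
        have := hest _ _ (hγS (n+1)) (hγS n) T t ht htT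
        rw [← hγs, ← hγs] at this
        exact this
    have hconv : ∀ t, ∃ x, Tendsto (fun n => γ n t) atTop (𝓝 x) := by
      intro t
      rcases lt_or_ge 0 t with ht | ht
      · refine cauchySeq_tendsto_of_complete (cauchySeq_of_summable_dist ?_)
        refine Summable.of_nonneg_of_le (fun _ => dist_nonneg) (fun n => ?_)
          ((Real.summable_pow_div_factorial (C t * t)).mul_left (U - L))
        rw [dist_comm, Real.dist_eq]
        exact hb t n t ht.le le_rfl
      · refine ⟨γ 1 t, tendsto_const_nhds.congr' ?_⟩
        filter_upwards [eventually_ge_atTop 1] with n hn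
        obtain ⟨m, rfl⟩ := Nat.exists_eq_add_of_le' hn
        rw [hγs, hγs]; exact hneg _ _ _ ht
    choose g hg using hconv
    have hgS : InS L U g := by
      refine ⟨measurable_of_tendsto_metrizable (fun n => (hγS n).1) (tendsto_pi_nhds.2 hg), ?_⟩
      intro t
      exact ⟨ge_of_tendsto' (hg t) fun n => ((hγS n).2 t).1,
        le_of_tendsto' (hg t) fun n => ((hγS n).2 t).2⟩
    refine ⟨g, hgS, funext fun t => ?_⟩
    have h1 : Tendsto (fun n => γ (n + 1) t) atTop (𝓝 (g t)) :=
      (hg t).comp (tendsto_add_atTop_nat 1)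
    refine tendsto_nhds_unique ?_ h1
    simp_rw [hγs]
    rcases lt_or_ge 0 t with ht | ht
    · have h2 : Tendsto (fun n => C t * ∫ s in Set.Ioc 0 t, |γ n s - g s|) atTop (𝓝 0) := by
        have : Tendsto (fun n => ∫ s in Set.Ioc 0 t, |γ n s - g s|) atTop
            (𝓝 (∫ s in Set.Ioc 0 t, (0:ℝ))) := by
          refine tendsto_integral_of_dominated_convergence (fun _ => U - L) ?_ ?_ ?_ ?_
          · intro n; exact ((hγS n).measurable_abs_sub hgS).aestronglyMeasurable
          · exact integrable_const _
          · intro n; refine ae_of_all _ fun s => ?_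
            rw [Real.norm_eq_abs, abs_abs]; exact (hγS n).abs_sub_le hgS s
          · refine ae_of_all _ fun s => ?_
            have := ((hg s).sub_const (g s)).abs
            simpa using this
        simpa using this.const_mul (C t)
      rw [tendsto_iff_dist_tendsto_zero]
      refine squeeze_zero (fun _ => dist_nonneg) (fun n => ?_) h2
      rw [Real.dist_eq]
      exact hest _ _ (hγS n) hgS t t ht.le le_rfl
    · exact tendsto_const_nhds.congr fun n => hneg _ _ _ ht
  · intro g g' hg hg' hf hf'
    funext t
    rcases lt_or_ge 0 t with ht | ht
    · have hb : ∀ n s, 0 ≤ s → s ≤ t →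
          |g s - g' s| ≤ (U - L) * ((C t * s) ^ n / n.factorial) := by
        refine picard_bound (hC t) (fun _ s => |g s - g' s|) ?_ ?_ ?_
        · intro n t; exact hg.integrableOn_abs_sub hg' 0 t
        · intro s; exact hg.abs_sub_le hg' s
        · intro n s hs hst
          have := hest _ _ hg hg' t s hs hst
          rw [hf, hf'] at this
          exact this
      have h1 : Tendsto (fun n : ℕ => (U - L) * ((C t * t) ^ n / n.factorial)) atTop (𝓝 0) := by
        simpa using (FloorSemiring.tendsto_pow_div_factorial_atTop (C t * t)).const_mul (U - L)
      have h2 : |g t - g' t| ≤ 0 := ge_of_tendsto' h1 fun n => hb n t ht.le le_rfl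
      exact sub_eq_zero.1 (abs_eq_zero.1 (le_antisymm h2 (abs_nonneg _)))
    · rw [← hf, ← hf']; exact hneg _ _ _ ht

/-- Cleaned-up data. -/
structure Clean [m0 : MeasurableSpace Ω] (L U : ℝ) (η : ℝ → Ω → ℝ) : Prop where
  hL : 0 < L
  hLU : L < U
  meas : Measurable (fun p : ℝ × Ω => η p.1 p.2)
  bdd : ∀ t ω, L ≤ η t ω ∧ η t ω ≤ U

section clean
variable {m0 : MeasurableSpace Ω} {L U : ℝ} {η : ℝ → Ω → ℝ} {l g g' : ℝ → ℝ}

lemma Clean.integrand_meas (h : Clean L U η) (hl : InS L U l) (hg : InS L U g) (ω : Ω) :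
    Measurable fun s => η s ω / g s * l s := by
  have h1 : Measurable fun s => η s ω := h.meas.comp (measurable_id.prodMk measurable_const)
  exact (h1.div hg.1).mul hl.1

lemma Clean.integrand_bdd (h : Clean L U η) (hl : InS L U l) (hg : InS L U g) (ω : Ω) (s : ℝ) :
    L / U * L ≤ η s ω / g s * l s ∧ η s ω / g s * l s ≤ U / L * U := by
  have := h.hL; have := h.hLU
  obtain ⟨h1, h2⟩ := h.bdd s ω
  obtain ⟨h3, h4⟩ := hl.2 s
  obtain ⟨h5, h6⟩ := hg.2 s
  have hg0 : 0 < g s := by linarith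
  have hU : 0 < U := by linarith
  have he : 0 < η s ω := by linarith
  have hl0 : 0 < l s := by linarith
  constructor <;> gcongr

lemma Clean.integrand_int (h : Clean L U η) (hl : InS L U l) (hg : InS L U g) (ω : Ω) (a t : ℝ) :
    IntegrableOn (fun s => η s ω / g s * l s) (Set.Ioc a t) := by
  refine integrableOn_of_bdd (h.integrand_meas hl hg ω) (B := U / L * U) (fun s => ?_) a t
  have := h.hL; have := h.hLU
  have h1 := h.integrand_bdd hl hg ω s
  have : 0 < U := by linarith
  have : 0 < L / U * L := by positivity
  rw [abs_of_nonneg (by linarith)]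
  exact h1.2

lemma Clean.J_nonneg (h : Clean L U η) (hl : InS L U l) (hg : InS L U g) (ω : Ω) (a t : ℝ) :
    0 ≤ J η l g a t ω := by
  have := h.hL; have := h.hLU
  have : 0 < U := by linarith
  have : 0 < L / U * L := by positivity
  exact integral_nonneg fun s => by have := (h.integrand_bdd hl hg ω s).1; simp; linarith

lemma Clean.J_le (h : Clean L U η) (hl : InS L U l) (hg : InS L U g) (ω : Ω) {a t : ℝ}
    (hat : a ≤ t) : J η l g a t ω ≤ U / L * U * (t - a) := by
  have h1 : J η l g a t ω ≤ ∫ s in Set.Ioc a t, U / L * U :=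
    setIntegral_mono_on (h.integrand_int hl hg ω a t) (integrable_const _)
      measurableSet_Ioc fun s _ => (h.integrand_bdd hl hg ω s).2
  refine h1.trans (le_of_eq ?_)
  simp [max_eq_left (sub_nonneg.2 hat)]; ring

lemma Clean.le_J (h : Clean L U η) (hl : InS L U l) (hg : InS L U g) (ω : Ω) {a t : ℝ}
    (hat : a ≤ t) : L / U * L * (t - a) ≤ J η l g a t ω := by
  have h1 : ∫ s in Set.Ioc a t, L / U * L ≤ J η l g a t ω :=
    setIntegral_mono_on (integrable_const _) (h.integrand_int hl hg ω a t)
      measurableSet_Ioc fun s _ => (h.integrand_bdd hl hg ω s).1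
  refine le_trans (le_of_eq ?_) h1
  simp [max_eq_left (sub_nonneg.2 hat)]; ring

lemma Clean.J_mono (h : Clean L U η) (hl : InS L U l) (hg : InS L U g) (ω : Ω) {a t u : ℝ}
    (htu : t ≤ u) : J η l g a t ω ≤ J η l g a u ω := by
  have := h.hL; have := h.hLU
  have : 0 < U := by linarith
  have : 0 < L / U * L := by positivity
  refine setIntegral_mono_set (h.integrand_int hl hg ω a u) ?_ ?_
  · exact ae_of_all _ fun s => by have := (h.integrand_bdd hl hg ω s).1; simp; linarith
  · exact (Set.Ioc_subset_Ioc_right htu).eventuallyLE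

lemma Clean.J_meas (h : Clean L U η) (hl : InS L U l) (hg : InS L U g) {τ : Ω → ℝ}
    (hτ : Measurable τ) : Measurable fun p : ℝ × Ω => J η l g (τ p.2) p.1 p.2 := by
  have h1 : ∀ p : ℝ × Ω, J η l g (τ p.2) p.1 p.2 =
      ∫ s, (if τ p.2 < s ∧ s ≤ p.1 then η s p.2 / g s * l s else 0) := by
    intro p
    rw [J, ← integral_indicator measurableSet_Ioc]
    congr 1
    ext s
    simp [Set.indicator, Set.mem_Ioc]
  simp_rw [h1]
  refine StronglyMeasurable.measurable ?_
  refine StronglyMeasurable.integral_prod_right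
    (f := fun (p : ℝ × Ω) s => (if τ p.2 < s ∧ s ≤ p.1 then η s p.2 / g s * l s else 0)) ?_
  refine Measurable.stronglyMeasurable ?_
  refine Measurable.ite ?_ ?_ measurable_const
  · exact (measurableSet_lt (hτ.comp (measurable_snd.comp measurable_fst)) measurable_snd).inter
      (measurableSet_le measurable_snd (measurable_fst.comp measurable_fst))
  · have e1 : Measurable fun p : (ℝ × Ω) × ℝ => η p.2 p.1.2 :=
      h.meas.comp (measurable_snd.prodMk (measurable_snd.comp measurable_fst))
    exact (e1.div (hg.1.comp measurable_snd)).mul (hl.1.comp measurable_snd)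

lemma Clean.J_sub (h : Clean L U η) (hl : InS L U l) (hg : InS L U g) (hg' : InS L U g') (ω : Ω)
    {a t : ℝ} (ha : 0 ≤ a) :
    |J η l g a t ω - J η l g' a t ω| ≤
      U * U / (L * L) * ∫ s in Set.Ioc 0 t, |g s - g' s| := by
  have hL := h.hL; have := h.hLU
  have hU : 0 < U := by linarith
  rw [J, J, ← integral_sub (h.integrand_int hl hg ω a t) (h.integrand_int hl hg' ω a t)]
  refine (abs_integral_le_integral_abs).trans ?_
  have h1 : ∫ s in Set.Ioc a t, |η s ω / g s * l s - η s ω / g' s * l s| ≤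
      ∫ s in Set.Ioc a t, U * U / (L * L) * |g s - g' s| := by
    refine setIntegral_mono_on
      ((h.integrand_int hl hg ω a t).sub (h.integrand_int hl hg' ω a t)).abs
      ((hg.integrableOn_abs_sub hg' a t).const_mul _) measurableSet_Ioc fun s _ => ?_
    obtain ⟨h1, h2⟩ := h.bdd s ω
    obtain ⟨h3, h4⟩ := hl.2 s
    obtain ⟨h5, h6⟩ := hg.2 s
    obtain ⟨h7, h8⟩ := hg'.2 s
    have hg0 : 0 < g s := by linarith
    have hg0' : 0 < g' s := by linarith
    have he : 0 < η s ω := by linarith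
    have hl0 : 0 < l s := by linarith
    have e : η s ω / g s * l s - η s ω / g' s * l s =
        η s ω * l s / (g s * g' s) * -(g s - g' s) := by field_simp; ring
    rw [e, abs_mul, abs_neg, abs_of_pos (by positivity)]
    gcongr
  refine h1.trans ?_
  rw [integral_const_mul]
  refine mul_le_mul_of_nonneg_left ?_ (by positivity)
  refine setIntegral_mono_set (hg.integrableOn_abs_sub hg' 0 t) ?_ ?_
  · exact ae_of_all _ fun s => abs_nonneg _
  · exact (Set.Ioc_subset_Ioc_left ha).eventuallyLE

lemma exp_neg_lip {a b : ℝ} (ha : 0 ≤ a) (hb : 0 ≤ b) :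
    |Real.exp (-a) - Real.exp (-b)| ≤ |a - b| := by
  wlog hab : a ≤ b generalizing a b
  · rw [abs_sub_comm, abs_sub_comm a b]; exact this hb ha (le_of_not_ge hab)
  have h1 : Real.exp (-b) ≤ Real.exp (-a) := Real.exp_le_exp.2 (by linarith)
  rw [abs_of_nonneg (by linarith), abs_of_nonpos (by linarith)]
  have h2 : Real.exp (-b) = Real.exp (-a) * Real.exp (-(b - a)) := by
    rw [← Real.exp_add]; congr 1; ring
  have h3 : Real.exp (-a) ≤ 1 := Real.exp_le_one_iff.2 (by linarith)
  have h4 := Real.add_one_le_exp (-(b - a))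
  have h5 := Real.exp_pos (-a)
  nlinarith

end clean

set_option linter.unusedSectionVars false

section fixedpoint
variable {m0 : MeasurableSpace Ω} {μ : Measure Ω} [IsProbabilityMeasure μ]
  {L U : ℝ} {η : ℝ → Ω → ℝ} {l g g' : ℝ → ℝ} {τ : Ω → ℝ}

lemma integral_ite_const (hτ : Measurable τ) (t M : ℝ) :
    ∫ ω, (if τ ω < t then M else 0) ∂μ = M * μ.real {ω | τ ω < t} := by
  have hm : MeasurableSet {ω | τ ω < t} := measurableSet_lt hτ measurable_const
  have h1 : (fun ω => if τ ω < t then M else 0) = {ω | τ ω < t}.indicator (fun _ => M) := by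
    ext ω; simp [Set.indicator]
  rw [h1, integral_indicator hm]
  simp [mul_comm]

lemma integrable_ite_const (hτ : Measurable τ) (t M : ℝ) :
    Integrable (fun ω => if τ ω < t then M else 0) μ := by
  have hm : MeasurableSet {ω | τ ω < t} := measurableSet_lt hτ measurable_const
  have h1 : (fun ω => if τ ω < t then M else 0) = {ω | τ ω < t}.indicator (fun _ => M) := by
    ext ω; simp [Set.indicator]
  rw [h1]
  exact (integrable_const _).indicator hm

lemma abs_integral_le_ite (hτ : Measurable τ) {t M : ℝ} {f : Ω → ℝ}
    (hf : ∀ ω, |f ω| ≤ if τ ω < t then M else 0) :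
    |∫ ω, f ω ∂μ| ≤ M * μ.real {ω | τ ω < t} := by
  rw [← integral_ite_const hτ]
  exact norm_integral_le_of_norm_le (integrable_ite_const hτ t M)
    (ae_of_all _ fun ω => (Real.norm_eq_abs _).trans_le (hf ω))

lemma Clean.w_meas (h : Clean L U η) (hl : InS L U l) (hg : InS L U g) (hτ : Measurable τ) :
    Measurable fun p : ℝ × Ω => if τ p.2 < p.1 then Real.exp (-J η l g (τ p.2) p.1 p.2) else 0 := by
  refine Measurable.ite ?_ ?_ measurable_const
  · exact measurableSet_lt (hτ.comp measurable_snd) measurable_fst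
  · exact (h.J_meas hl hg hτ).neg.exp

lemma Clean.nw_meas (h : Clean L U η) (hl : InS L U l) (hg : InS L U g) (hτ : Measurable τ) :
    Measurable fun p : ℝ × Ω =>
      if τ p.2 < p.1 then η p.1 p.2 * Real.exp (-J η l g (τ p.2) p.1 p.2) else 0 := by
  refine Measurable.ite ?_ ?_ measurable_const
  · exact measurableSet_lt (hτ.comp measurable_snd) measurable_fst
  · exact h.meas.mul (h.J_meas hl hg hτ).neg.exp

lemma Clean.exp_le (h : Clean L U η) (hl : InS L U l) (hg : InS L U g) (a t : ℝ) (ω : Ω) :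
    Real.exp (-J η l g a t ω) ≤ 1 :=
  Real.exp_le_one_iff.2 (by have := h.J_nonneg hl hg ω a t; linarith)

lemma Clean.w_int (h : Clean L U η) (hl : InS L U l) (hg : InS L U g) (hτ : Measurable τ) (t : ℝ) :
    Integrable (fun ω => if τ ω < t then Real.exp (-J η l g (τ ω) t ω) else 0) μ := by
  refine (integrable_const (1 : ℝ)).mono'
    ((h.w_meas hl hg hτ).comp measurable_prodMk_left).aestronglyMeasurable (ae_of_all _ fun ω => ?_)
  split_ifs
  · rw [Real.norm_eq_abs, abs_of_pos (Real.exp_pos _)]; exact h.exp_le hl hg _ _ _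
  · simp

lemma Clean.nw_int (h : Clean L U η) (hl : InS L U l) (hg : InS L U g) (hτ : Measurable τ)
    (t : ℝ) :
    Integrable (fun ω => if τ ω < t then η t ω * Real.exp (-J η l g (τ ω) t ω) else 0) μ := by
  have hL := h.hL; have := h.hLU
  have hU : 0 < U := by linarith
  refine (integrable_const U).mono'
    ((h.nw_meas hl hg hτ).comp measurable_prodMk_left).aestronglyMeasurable (ae_of_all _ fun ω => ?_)
  split_ifs
  · have h1 := h.bdd t ω
    have h2 : 0 < η t ω := by linarith
    rw [Real.norm_eq_abs, abs_of_pos (by positivity)]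
    have h3 := h.exp_le hl hg (τ ω) t ω
    calc η t ω * Real.exp (-J η l g (τ ω) t ω) ≤ U * 1 := by gcongr; exact h1.2
      _ = U := mul_one _
  · simp [hU.le]

lemma Clean.D_lower (h : Clean L U η) (hl : InS L U l) (hg : InS L U g) (hτ : Measurable τ)
    (h0 : ∀ ω, 0 ≤ τ ω) (t : ℝ) :
    Real.exp (-(U / L * U * t)) * μ.real {ω | τ ω < t} ≤ Dn μ η l τ g t := by
  have hL := h.hL; have := h.hLU
  have hU : 0 < U := by linarith
  rw [← integral_ite_const hτ]
  refine integral_mono (integrable_ite_const hτ t _) (h.w_int hl hg hτ t) fun ω => ?_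
  dsimp only
  split_ifs with hlt
  · refine Real.exp_le_exp.2 (neg_le_neg ?_)
    refine (h.J_le hl hg ω hlt.le).trans ?_
    have := h0 ω
    gcongr
    linarith
  · exact le_rfl

lemma Clean.N_bdd (h : Clean L U η) (hl : InS L U l) (hg : InS L U g) (hτ : Measurable τ) (t : ℝ) :
    L * Dn μ η l τ g t ≤ Nn μ η l τ g t ∧ Nn μ η l τ g t ≤ U * Dn μ η l τ g t := by
  rw [Dn, Nn, ← integral_const_mul, ← integral_const_mul]
  constructor
  · refine integral_mono ((h.w_int hl hg hτ t).const_mul L) (h.nw_int hl hg hτ t) fun ω => ?_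
    dsimp only
    split_ifs with hlt
    · exact mul_le_mul_of_nonneg_right (h.bdd t ω).1 (Real.exp_pos _).le
    · simp
  · refine integral_mono (h.nw_int hl hg hτ t) ((h.w_int hl hg hτ t).const_mul U) fun ω => ?_
    dsimp only
    split_ifs with hlt
    · exact mul_le_mul_of_nonneg_right (h.bdd t ω).2 (Real.exp_pos _).le
    · simp

lemma Clean.D_pos (h : Clean L U η) (hl : InS L U l) (hg : InS L U g) (hτ : Measurable τ)
    (h0 : ∀ ω, 0 ≤ τ ω) {t : ℝ} (hp : 0 < μ.real {ω | τ ω < t}) : 0 < Dn μ η l τ g t :=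
  lt_of_lt_of_le (mul_pos (Real.exp_pos _) hp) (h.D_lower hl hg hτ h0 t)

lemma Clean.exp_sub (h : Clean L U η) (hl : InS L U l) (hg : InS L U g) (hg' : InS L U g') (ω : Ω)
    {a t : ℝ} (ha : 0 ≤ a) :
    |Real.exp (-J η l g a t ω) - Real.exp (-J η l g' a t ω)| ≤
      U * U / (L * L) * ∫ s in Set.Ioc 0 t, |g s - g' s| :=
  (exp_neg_lip (h.J_nonneg hl hg ω a t) (h.J_nonneg hl hg' ω a t)).trans
    (h.J_sub hl hg hg' ω ha)

lemma Clean.D_sub (h : Clean L U η) (hl : InS L U l) (hg : InS L U g) (hg' : InS L U g')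
    (hτ : Measurable τ) (h0 : ∀ ω, 0 ≤ τ ω) (t : ℝ) :
    |Dn μ η l τ g t - Dn μ η l τ g' t| ≤
      (U * U / (L * L) * ∫ s in Set.Ioc 0 t, |g s - g' s|) * μ.real {ω | τ ω < t} := by
  rw [Dn, Dn, ← integral_sub (h.w_int hl hg hτ t) (h.w_int hl hg' hτ t)]
  refine abs_integral_le_ite hτ fun ω => ?_
  split_ifs with hlt
  · exact h.exp_sub hl hg hg' ω (h0 ω)
  · simp

lemma Clean.N_sub (h : Clean L U η) (hl : InS L U l) (hg : InS L U g) (hg' : InS L U g')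
    (hτ : Measurable τ) (h0 : ∀ ω, 0 ≤ τ ω) (t : ℝ) :
    |Nn μ η l τ g t - Nn μ η l τ g' t| ≤
      (U * (U * U / (L * L) * ∫ s in Set.Ioc 0 t, |g s - g' s|)) * μ.real {ω | τ ω < t} := by
  have hL := h.hL; have := h.hLU
  have hU : 0 < U := by linarith
  rw [Nn, Nn, ← integral_sub (h.nw_int hl hg hτ t) (h.nw_int hl hg' hτ t)]
  refine abs_integral_le_ite hτ fun ω => ?_
  split_ifs with hlt
  · rw [← mul_sub, abs_mul]
    have h1 := h.bdd t ω
    have h2 : 0 < η t ω := by linarith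
    rw [abs_of_pos h2]
    exact mul_le_mul h1.2 (h.exp_sub hl hg hg' ω (h0 ω)) (abs_nonneg _) hU.le
  · simp

lemma Clean.Ph_InS (h : Clean L U η) (hl : InS L U l) (hg : InS L U g)
    (hτ : Measurable τ) (h0 : ∀ ω, 0 ≤ τ ω) (hp : ∀ t, 0 < t → 0 < μ.real {ω | τ ω < t}) :
    InS L U (Ph μ L η l τ g) := by
  constructor
  · refine Measurable.ite (measurableSet_lt measurable_const measurable_id) ?_ measurable_const
    refine Measurable.div ?_ ?_
    · exact (StronglyMeasurable.integral_prod_right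
        (f := fun (t : ℝ) ω => if τ ω < t then η t ω * Real.exp (-J η l g (τ ω) t ω) else 0)
        (h.nw_meas hl hg hτ).stronglyMeasurable).measurable
    · exact (StronglyMeasurable.integral_prod_right
        (f := fun (t : ℝ) ω => if τ ω < t then Real.exp (-J η l g (τ ω) t ω) else 0)
        (h.w_meas hl hg hτ).stronglyMeasurable).measurable
  · intro t
    rw [Ph]
    split_ifs with ht
    · have hD := h.D_pos hl hg hτ h0 (hp t ht)
      have hN := h.N_bdd (μ := μ) hl hg hτ t
      rw [le_div_iff₀ hD, div_le_iff₀ hD]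
      exact hN
    · exact ⟨le_rfl, h.hLU.le⟩

lemma Clean.Ph_sub (h : Clean L U η) (hl : InS L U l) (hg : InS L U g) (hg' : InS L U g')
    (hτ : Measurable τ) (h0 : ∀ ω, 0 ≤ τ ω) (hp : ∀ t, 0 < t → 0 < μ.real {ω | τ ω < t})
    {t T : ℝ} (ht : 0 ≤ t) (htT : t ≤ T) :
    |Ph μ L η l τ g t - Ph μ L η l τ g' t| ≤
      (2 * U * (U * U / (L * L)) * Real.exp (U / L * U * T)) *
        ∫ s in Set.Ioc 0 t, |g s - g' s| := by
  have hL := h.hL; have := h.hLU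
  have hU : 0 < U := by linarith
  have hI : 0 ≤ ∫ s in Set.Ioc 0 t, |g s - g' s| := integral_nonneg fun _ => abs_nonneg _
  rcases ht.eq_or_lt with rfl | ht0
  · simp [Ph]
  have hD := h.D_pos hl hg hτ h0 (hp t ht0)
  have hD' := h.D_pos hl hg' hτ h0 (hp t ht0)
  have hb := ((h.Ph_InS hl hg' hτ h0 hp).2 t)
  have hDs := h.D_sub (μ := μ) hl hg hg' hτ h0 t
  have hNs := h.N_sub (μ := μ) hl hg hg' hτ h0 t
  have hDl := h.D_lower (μ := μ) hl hg hτ h0 t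
  have hpt := hp t ht0
  have e : Ph μ L η l τ g t * Dn μ η l τ g t = Nn μ η l τ g t := by
    rw [Ph, if_pos ht0, div_mul_cancel₀ _ hD.ne']
  have e' : Ph μ L η l τ g' t * Dn μ η l τ g' t = Nn μ η l τ g' t := by
    rw [Ph, if_pos ht0, div_mul_cancel₀ _ hD'.ne']
  generalize Ph μ L η l τ g t = x at *
  generalize Ph μ L η l τ g' t = y at *
  generalize Dn μ η l τ g t = D at *
  generalize Dn μ η l τ g' t = D' at *
  generalize μ.real {ω | τ ω < t} = p at *
  generalize Nn μ η l τ g t = N at *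
  generalize Nn μ η l τ g' t = N' at *
  generalize ∫ s in Set.Ioc 0 t, |g s - g' s| = I at *
  have hK : 0 < U * U / (L * L) := by positivity
  have hB : 0 < U / L * U := by positivity
  generalize U * U / (L * L) = K at *
  generalize U / L * U = B at *
  have h1 : (x - y) * D = (N - N') - y * (D - D') := by rw [← e, ← e']; ring
  have h2 : |x - y| * D ≤ 2 * U * K * I * p := by
    rw [← abs_of_pos hD, ← abs_mul, h1]
    have hy : |y| ≤ U := by rw [abs_of_pos (by linarith)]; exact hb.2
    calc |N - N' - y * (D - D')| ≤ |N - N'| + |y * (D - D')| := abs_sub _ _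
      _ ≤ (U * (K * I)) * p + U * ((K * I) * p) := by
        rw [abs_mul]
        exact add_le_add hNs (mul_le_mul hy hDs (abs_nonneg _) hU.le)
      _ = _ := by ring
  have h3 : |x - y| * Real.exp (-(B * t)) * p ≤ 2 * U * K * I * p := by
    refine le_trans ?_ h2
    rw [mul_assoc]
    exact mul_le_mul_of_nonneg_left hDl (abs_nonneg _)
  have h4 := le_of_mul_le_mul_right h3 hpt
  have h5 : |x - y| ≤ 2 * U * K * I * Real.exp (B * t) := by
    have := mul_le_mul_of_nonneg_right h4 (Real.exp_pos (B * t)).le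
    rwa [mul_assoc, ← Real.exp_add, neg_add_cancel, Real.exp_zero, mul_one] at this
  calc |x - y| ≤ 2 * U * K * I * Real.exp (B * t) := h5
    _ ≤ 2 * U * K * I * Real.exp (B * T) := by gcongr
    _ = _ := by ring

/-- Existence and uniqueness for one step with clean data. -/
lemma Clean.one_step (h : Clean L U η) (hl : InS L U l)
    (hτ : Measurable τ) (h0 : ∀ ω, 0 ≤ τ ω) (hp : ∀ t, 0 < t → 0 < μ.real {ω | τ ω < t}) :
    ∃ γ, InS L U γ ∧ (∀ t, 0 < t → γ t * Dn μ η l τ γ t = Nn μ η l τ γ t) ∧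
      ∀ γ', InS L U γ' → (∀ᵐ t ∂(volume.restrict (Set.Ici (0:ℝ))),
        γ' t * Dn μ η l τ γ' t = Nn μ η l τ γ' t) →
        ∀ᵐ t ∂(volume.restrict (Set.Ici (0:ℝ))), γ t = γ' t := by
  have hL := h.hL; have := h.hLU
  have hU : 0 < U := by linarith
  obtain ⟨⟨γ, hγS, hγ⟩, huniq⟩ := abstract_fp h.hLU.le (Ph μ L η l τ)
    (fun g hg => h.Ph_InS hl hg hτ h0 hp)
    (fun g g' t ht => by simp [Ph, not_lt.2 ht])
    (fun T => 2 * U * (U * U / (L * L)) * Real.exp (U / L * U * T)) (fun T => by positivity)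
    (fun g g' hg hg' T t ht htT => h.Ph_sub hl hg hg' hτ h0 hp ht htT)
  refine ⟨γ, hγS, ?_, ?_⟩
  · intro t ht
    have hD := h.D_pos hl hγS hτ h0 (hp t ht)
    have h1 := congrFun hγ t
    rw [Ph, if_pos ht] at h1
    rw [div_eq_iff hD.ne'] at h1
    exact h1.symm
  · intro γ' hγ' heq
    have hpos : ∀ᵐ t ∂(volume.restrict (Set.Ici (0:ℝ))), 0 < t := by
      rw [← restrict_Ioi_eq_restrict_Ici]
      exact ae_restrict_mem measurableSet_Ioi
    have hae : ∀ᵐ t ∂(volume.restrict (Set.Ici (0:ℝ))), Ph μ L η l τ γ' t = γ' t := by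
      filter_upwards [heq, hpos] with t h1 ht
      have hD := h.D_pos hl hγ' hτ h0 (hp t ht)
      rw [Ph, if_pos ht, div_eq_iff hD.ne', h1]
    have hS' := h.Ph_InS (μ := μ) hl hγ' hτ h0 hp
    have hfix : ∀ t, Ph μ L η l τ (Ph μ L η l τ γ') t = Ph μ L η l τ γ' t := by
      intro t
      rcases lt_or_ge 0 t with ht | ht
      · have h1 := h.Ph_sub (μ := μ) hl hS' hγ' hτ h0 hp ht.le le_rfl
        have h2 : ∫ s in Set.Ioc 0 t, |Ph μ L η l τ γ' s - γ' s| = 0 := by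
          have h3 : ∀ᵐ s ∂(volume.restrict (Set.Ioc 0 t)), |Ph μ L η l τ γ' s - γ' s| = 0 := by
            have h4 : ∀ᵐ s ∂(volume.restrict (Set.Ioc 0 t)), Ph μ L η l τ γ' s = γ' s :=
              ae_mono (Measure.restrict_mono (fun s hs => hs.1.le) le_rfl) hae
            filter_upwards [h4] with s hs
            simp [hs]
          rw [integral_congr_ae h3]; simp
        rw [h2, mul_zero] at h1
        exact sub_eq_zero.1 (abs_eq_zero.1 (le_antisymm h1 (abs_nonneg _)))
      · simp [Ph, not_lt.2 ht]
    have := huniq γ _ hγS hS' (fun t => congrFun hγ t) hfix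
    filter_upwards [hae] with t ht
    rw [← ht, this]

end fixedpoint

/-- The next jump time. -/
def nextTau (E : Ω → ℝ) (η : ℝ → Ω → ℝ) (l g : ℝ → ℝ) (τ : Ω → ℝ) (ω : Ω) : ℝ :=
  sInf {t : ℝ | τ ω < t ∧ E ω ≤ J η l g (τ ω) t ω}

section jumps
variable {m0 : MeasurableSpace Ω} {L U : ℝ} {η : ℝ → Ω → ℝ} {l g : ℝ → ℝ} {τ E : Ω → ℝ}

lemma nextTau_bddBelow (ω : Ω) : BddBelow {t : ℝ | τ ω < t ∧ E ω ≤ J η l g (τ ω) t ω} :=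
  ⟨τ ω, fun _ ht => ht.1.le⟩

lemma Clean.mem_next (h : Clean L U η) (hl : InS L U l) (hg : InS L U g) (ω : Ω) {ε : ℝ}
    (hε : 0 < ε) (hE : E ω ≤ ε) :
    τ ω + ε / (L / U * L) ∈ {t : ℝ | τ ω < t ∧ E ω ≤ J η l g (τ ω) t ω} := by
  have hL := h.hL; have := h.hLU
  have hU : 0 < U := by linarith
  have hc : 0 < L / U * L := by positivity
  have h1 : 0 < ε / (L / U * L) := by positivity
  refine ⟨by linarith, ?_⟩
  have h2 := h.le_J hl hg ω (a := τ ω) (t := τ ω + ε / (L / U * L)) (by linarith)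
  rw [add_sub_cancel_left, mul_div_cancel₀ _ hc.ne'] at h2
  linarith

lemma Clean.next_nonempty (h : Clean L U η) (hl : InS L U l) (hg : InS L U g) (ω : Ω) :
    {t : ℝ | τ ω < t ∧ E ω ≤ J η l g (τ ω) t ω}.Nonempty :=
  ⟨_, h.mem_next hl hg ω (ε := max (E ω) 1) (lt_of_lt_of_le one_pos (le_max_right _ _))
    (le_max_left _ _)⟩

lemma Clean.next_ge (h : Clean L U η) (hl : InS L U l) (hg : InS L U g) (ω : Ω) :
    τ ω ≤ nextTau E η l g τ ω :=
  le_csInf (h.next_nonempty hl hg ω) fun _ ht => ht.1.le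

lemma Clean.next_le (h : Clean L U η) (hl : InS L U l) (hg : InS L U g) (ω : Ω) {ε : ℝ}
    (hε : 0 < ε) (hE : E ω ≤ ε) : nextTau E η l g τ ω ≤ τ ω + ε / (L / U * L) :=
  csInf_le (nextTau_bddBelow ω) (h.mem_next hl hg ω hε hE)

lemma Clean.next_meas (h : Clean L U η) (hl : InS L U l) (hg : InS L U g) (hτ : Measurable τ)
    (hE : Measurable E) : Measurable (nextTau E η l g τ) := by
  refine measurable_of_Iio fun t => ?_
  have h1 : nextTau E η l g τ ⁻¹' Set.Iio t =
      ⋃ q : ℚ, {ω | (q : ℝ) < t ∧ τ ω < q ∧ E ω ≤ J η l g (τ ω) q ω} := by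
    ext ω
    simp only [Set.mem_preimage, Set.mem_Iio, Set.mem_iUnion, Set.mem_ofPred_eq]
    rw [nextTau, csInf_lt_iff (nextTau_bddBelow ω) (h.next_nonempty hl hg ω)]
    constructor
    · rintro ⟨u, ⟨hu1, hu2⟩, hut⟩
      obtain ⟨q, hq1, hq2⟩ := exists_rat_btwn hut
      exact ⟨q, hq2, hu1.trans hq1, hu2.trans (h.J_mono hl hg ω hq1.le)⟩
    · rintro ⟨q, hq, h1, h2⟩
      exact ⟨q, ⟨h1, h2⟩, hq⟩
  rw [h1]
  refine MeasurableSet.iUnion fun q => ?_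
  refine (MeasurableSet.const _).inter ((measurableSet_lt hτ measurable_const).inter ?_)
  exact measurableSet_le hE ((h.J_meas hl hg hτ).comp measurable_prodMk_left)

lemma J_congr {η' : ℝ → Ω → ℝ} {l' g' : ℝ → ℝ} {ω : Ω}
    (h : ∀ᵐ s ∂(volume.restrict (Set.Ici (0:ℝ))), η s ω / g s * l s = η' s ω / g' s * l' s)
    {a : ℝ} (ha : 0 ≤ a) (t : ℝ) : J η l g a t ω = J η' l' g' a t ω := by
  refine integral_congr_ae ?_
  exact ae_mono (Measure.restrict_mono (fun s hs => ha.trans hs.1.le) le_rfl) h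

lemma tau_congr {η' : ℝ → Ω → ℝ} {l l' g g' : ℕ → ℝ → ℝ} {E τ τ' : ℕ → Ω → ℝ} {ω : Ω}
    (h0 : τ 0 ω = 0) (h0' : τ' 0 ω = 0) (hpos : ∀ k, 0 ≤ τ' k ω)
    (hs : ∀ k, τ (k + 1) ω = nextTau (E k) η (l k) (g k) (τ k) ω)
    (hs' : ∀ k, τ' (k + 1) ω = nextTau (E k) η' (l' k) (g' k) (τ' k) ω)
    (k : ℕ) (h : ∀ j < k, ∀ᵐ s ∂(volume.restrict (Set.Ici (0:ℝ))),
      η s ω / g j s * l j s = η' s ω / g' j s * l' j s) :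
    τ k ω = τ' k ω := by
  induction k with
  | zero => rw [h0, h0']
  | succ k ih =>
    have h1 := ih fun j hj => h j (hj.trans (Nat.lt_succ_self k))
    rw [hs, hs', nextTau, nextTau, h1]
    simp_rw [J_congr (h k (Nat.lt_succ_self k)) (hpos k)]

end jumps

section seq
variable {m0 : MeasurableSpace Ω} {μ : Measure Ω} [IsProbabilityMeasure μ]
  {L U : ℝ} {η : ℝ → Ω → ℝ}

lemma expOne_pos {E : Ω → ℝ} (hE : IsExpOne μ E) {ε : ℝ} (hε : 0 < ε) :
    0 < μ {ω | E ω ≤ ε} := by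
  rw [pos_iff_ne_zero]
  intro h0
  have hm : MeasurableSet {ω | E ω ≤ ε} := measurableSet_le hE.1 measurable_const
  have h1 := (prob_compl_eq_one_iff hm).2 h0
  have h2 : {ω | E ω ≤ ε}ᶜ = {ω | ε < E ω} := by ext ω; simp
  rw [h2, hE.2 ε hε.le, ENNReal.ofReal_eq_one] at h1
  rw [Real.exp_eq_one_iff] at h1
  linarith

/-- The full recursion for clean data. -/
lemma Clean.sequence (h : Clean L U η) {l : ℕ → ℝ → ℝ} (hl : ∀ k, InS L U (l k))
    {E : ℕ → Ω → ℝ} (hE : ∀ k, IsExpOne μ (E k))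
    (hind : iIndep (fun k => MeasurableSpace.comap (E k) inferInstance) μ) :
    ∃ (γ : ℕ → ℝ → ℝ) (T : ℕ → Ω → ℝ), (∀ k, InS L U (γ k)) ∧ (∀ ω, T 0 ω = 0) ∧
      (∀ k ω, T (k + 1) ω = nextTau (E k) η (l k) (γ k) (T k) ω) ∧ (∀ k ω, 0 ≤ T k ω) ∧
      (∀ k t, 0 < t → γ k t * Dn μ η (l k) (T k) (γ k) t = Nn μ η (l k) (T k) (γ k) t) ∧
      ∀ k γ', InS L U γ' → (∀ᵐ t ∂(volume.restrict (Set.Ici (0:ℝ))),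
        γ' t * Dn μ η (l k) (T k) γ' t = Nn μ η (l k) (T k) γ' t) →
        ∀ᵐ t ∂(volume.restrict (Set.Ici (0:ℝ))), γ k t = γ' t := by
  have hL := h.hL; have hLU := h.hLU
  have hU : 0 < U := by linarith
  have hc : 0 < L / U * L := by positivity
  have hG : ∀ (k : ℕ) (τ : Ω → ℝ), ∃ γ, InS L U γ ∧
      ((Measurable τ ∧ (∀ ω, 0 ≤ τ ω) ∧ ∀ t, 0 < t → 0 < μ.real {ω | τ ω < t}) →
      (∀ t, 0 < t → γ t * Dn μ η (l k) τ γ t = Nn μ η (l k) τ γ t) ∧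
      ∀ γ', InS L U γ' → (∀ᵐ t ∂(volume.restrict (Set.Ici (0:ℝ))),
        γ' t * Dn μ η (l k) τ γ' t = Nn μ η (l k) τ γ' t) →
        ∀ᵐ t ∂(volume.restrict (Set.Ici (0:ℝ))), γ t = γ' t) := by
    intro k τ
    by_cases hτ : Measurable τ ∧ (∀ ω, 0 ≤ τ ω) ∧ ∀ t, 0 < t → 0 < μ.real {ω | τ ω < t}
    · obtain ⟨γ, h1, h2⟩ := h.one_step (hl k) hτ.1 hτ.2.1 hτ.2.2
      exact ⟨γ, h1, fun _ => h2⟩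
    · exact ⟨fun _ => L, ⟨measurable_const, fun _ => ⟨le_rfl, hLU.le⟩⟩, fun h => absurd h hτ⟩
  choose G hGS hGP using hG
  let T : ℕ → Ω → ℝ := fun n => Nat.rec (fun _ => 0)
    (fun k τ => nextTau (E k) η (l k) (G k τ) τ) n
  have hT0 : ∀ ω, T 0 ω = 0 := fun _ => rfl
  have hTs : ∀ k, T (k + 1) = nextTau (E k) η (l k) (G k (T k)) (T k) := fun _ => rfl
  have hTm : ∀ k, Measurable (T k) := by
    intro k
    induction k with
    | zero => exact measurable_const
    | succ k ih => rw [hTs]; exact h.next_meas (hl k) (hGS _ _) ih (hE k).1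
  have hTp : ∀ k ω, 0 ≤ T k ω := by
    intro k ω
    induction k with
    | zero => exact le_rfl
    | succ k ih => rw [hTs]; exact ih.trans (h.next_ge (hl k) (hGS _ _) ω)
  have hTle : ∀ ε : ℝ, 0 < ε → ∀ k ω, (∀ j < k, E j ω ≤ ε) →
      T k ω ≤ k * (ε / (L / U * L)) := by
    intro ε hε k ω
    induction k with
    | zero => intro _; simp [hT0]
    | succ k ih =>
      intro hj
      have h1 := ih fun j hjk => hj j (hjk.trans (Nat.lt_succ_self k))
      rw [hTs]
      have h2 := h.next_le (τ := T k) (hl k) (hGS k (T k)) ω hε (hj k (Nat.lt_succ_self k))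
      push_cast
      linarith
  have hpos : ∀ k t, 0 < t → 0 < μ.real {ω | T k ω < t} := by
    intro k t ht
    let ε : ℝ := (L / U * L) * t / (k + 1)
    have hε : 0 < ε := by positivity
    have hsub : (⋂ j ∈ Finset.range k, {ω | E j ω ≤ ε}) ⊆ {ω | T k ω < t} := by
      intro ω hω
      simp only [Set.mem_iInter, Finset.mem_range, Set.mem_ofPred_eq] at hω
      refine lt_of_le_of_lt (hTle ε hε k ω hω) ?_
      have : (k : ℝ) * (ε / (L / U * L)) = k / (k + 1) * t := by
        simp only [ε]; field_simp
      rw [this]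
      have h2 : (k : ℝ) / (k + 1) < 1 := by rw [div_lt_one (by positivity)]; linarith
      nlinarith
    have h1 : μ (⋂ j ∈ Finset.range k, {ω | E j ω ≤ ε}) =
        ∏ j ∈ Finset.range k, μ {ω | E j ω ≤ ε} := by
      refine hind.meas_biInter fun j _ => ?_
      exact ⟨Set.Iic ε, measurableSet_Iic, rfl⟩
    have h2 : 0 < μ (⋂ j ∈ Finset.range k, {ω | E j ω ≤ ε}) := by
      rw [h1, pos_iff_ne_zero, Finset.prod_ne_zero_iff]
      intro j _
      exact (expOne_pos (hE j) hε).ne'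
    exact ENNReal.toReal_pos (h2.trans_le (measure_mono hsub)).ne' (measure_ne_top _ _)
  refine ⟨fun k => G k (T k), T, fun k => hGS _ _, hT0, fun k ω => congrFun (hTs k) ω, hTp, ?_, ?_⟩
  · intro k; exact (hGP k (T k) ⟨hTm k, hTp k, hpos k⟩).1
  · intro k; exact (hGP k (T k) ⟨hTm k, hTp k, hpos k⟩).2

end seq

/-- Clamping to `[L, U]`. -/
def clamp (L U x : ℝ) : ℝ := max L (min x U)

lemma clamp_bdd {L U : ℝ} (h : L ≤ U) (x : ℝ) : L ≤ clamp L U x ∧ clamp L U x ≤ U :=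
  ⟨le_max_left _ _, max_le h (min_le_right _ _)⟩

lemma clamp_eq {L U x : ℝ} (h : L ≤ x ∧ x ≤ U) : clamp L U x = x := by
  rw [clamp, min_eq_left h.2, max_eq_right h.1]

lemma clamp_meas {L U : ℝ} : Measurable (clamp L U) :=
  measurable_const.max (measurable_id.min measurable_const)

lemma progMeas_joint {m0 : MeasurableSpace Ω} {F : ℝ → MeasurableSpace Ω}
    (hF : ∀ t, F t ≤ m0) {η : ℝ → Ω → ℝ} (hη : ProgMeas F η) :
    Measurable (fun p : ℝ × Ω => η (max 0 p.1) p.2) := by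
  have h1 : ∀ n : ℕ, Measurable (fun p : ℝ × Ω => η (max 0 (min (n : ℝ) p.1)) p.2) := by
    intro n
    have hn : (0 : ℝ) ≤ n := Nat.cast_nonneg n
    have h2 : Measurable (fun p : Set.Icc (0:ℝ) n × Ω => η p.1 p.2) :=
      (hη n hn).mono (sup_le_sup le_rfl (MeasurableSpace.comap_mono (hF n))) le_rfl
    have h3 : Measurable (fun p : ℝ × Ω => ((Set.projIcc (0:ℝ) n hn p.1, p.2) :
        Set.Icc (0:ℝ) n × Ω)) :=
      (continuous_projIcc.measurable.comp measurable_fst).prodMk measurable_snd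
    exact h2.comp h3
  refine measurable_of_tendsto_metrizable h1 (tendsto_pi_nhds.2 fun p => ?_)
  refine tendsto_const_nhds.congr' ?_
  obtain ⟨N, hN⟩ := exists_nat_ge p.1
  filter_upwards [eventually_ge_atTop N] with n hn
  have : p.1 ≤ n := hN.trans (by exact_mod_cast hn)
  rw [min_eq_right this]

/-- Existence and a.e.-uniqueness of the fixed point sequence `(γ_k)` for
the counting-process inversion: with the jump times `τ` built by the Cox recursion from `γ`,
each `γ_k` satisfies
`γ_k(t)·E[1_{τ_k < t} e^{−∫_{τ_k}^t (η_s/γ_k(s)) λ(s,k) ds}] = E[η_t·1_{τ_k < t} e^{−∫_{τ_k}^t (η_s/γ_k(s)) λ(s,k) ds}]`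
for Lebesgue-a.e. `t ≥ 0`. -/
theorem fixed_point_counting
    {m0 : MeasurableSpace Ω} (μ : Measure Ω) [IsProbabilityMeasure μ]
    (F : ℝ → MeasurableSpace Ω) (hUC : UsualConditions μ F)
    (L U : ℝ) (hL : 0 < L) (hLU : L < U)
    (η : ℝ → Ω → ℝ) (hη_prog : ProgMeas F η)
    (hη_bdd : ∀ᵐ p ∂(μ.prod (volume.restrict (Set.Ici (0:ℝ)))),
      L ≤ η p.2 p.1 ∧ η p.2 p.1 ≤ U)
    (lam : ℝ → ℕ → ℝ) (hlam_meas : ∀ x : ℕ, Measurable (fun t => lam t x))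
    (hlam_bdd : ∀ x : ℕ, ∀ᵐ t ∂(volume.restrict (Set.Ici (0:ℝ))),
      L ≤ lam t x ∧ lam t x ≤ U)
    (E : ℕ → Ω → ℝ) (hE : ∀ k, IsExpOne μ (E k))
    (hindep : iIndep (fun i : Option ℕ =>
      Option.elim i (Finfty F)
        (fun k => MeasurableSpace.comap (E k) inferInstance)) μ) :
    ∃ γ : ℕ → ℝ → ℝ,
      (∀ k, Measurable (γ k)) ∧ (∀ (k : ℕ) (t : ℝ), L ≤ γ k t ∧ γ k t ≤ U) ∧
      (∀ τ : ℕ → Ω → ℝ, (∀ ω, τ 0 ω = 0) →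
        (∀ (k : ℕ) (ω : Ω), τ (k + 1) ω =
          sInf {t : ℝ | τ k ω < t ∧
            E k ω ≤ ∫ s in Set.Ioc (τ k ω) t, η s ω / γ k s * lam s k}) →
        ∀ k : ℕ, ∀ᵐ t ∂(volume.restrict (Set.Ici (0:ℝ))),
          γ k t *
            ∫ ω, (if τ k ω < t then
              Real.exp (-∫ s in Set.Ioc (τ k ω) t, η s ω / γ k s * lam s k) else 0) ∂μ =
          ∫ ω, (if τ k ω < t then
            η t ω *
              Real.exp (-∫ s in Set.Ioc (τ k ω) t, η s ω / γ k s * lam s k) else 0) ∂μ) ∧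
      ∀ γ' : ℕ → ℝ → ℝ,
        (∀ k, Measurable (γ' k)) → (∀ (k : ℕ) (t : ℝ), L ≤ γ' k t ∧ γ' k t ≤ U) →
        (∀ τ : ℕ → Ω → ℝ, (∀ ω, τ 0 ω = 0) →
          (∀ (k : ℕ) (ω : Ω), τ (k + 1) ω =
            sInf {t : ℝ | τ k ω < t ∧
              E k ω ≤ ∫ s in Set.Ioc (τ k ω) t, η s ω / γ' k s * lam s k}) →
          ∀ k : ℕ, ∀ᵐ t ∂(volume.restrict (Set.Ici (0:ℝ))),
            γ' k t *
              ∫ ω, (if τ k ω < t then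
                Real.exp (-∫ s in Set.Ioc (τ k ω) t, η s ω / γ' k s * lam s k) else 0) ∂μ =
            ∫ ω, (if τ k ω < t then
              η t ω *
                Real.exp (-∫ s in Set.Ioc (τ k ω) t, η s ω / γ' k s * lam s k) else 0) ∂μ) →
        ∀ k : ℕ, ∀ᵐ t ∂(volume.restrict (Set.Ici (0:ℝ))), γ k t = γ' k t := by
  classical
  obtain ⟨⟨hFmono, hFle⟩, -, -⟩ := hUC
  let ηc : ℝ → Ω → ℝ := fun t ω => clamp L U (η (max 0 t) ω)
  let lc : ℕ → ℝ → ℝ := fun k t => clamp L U (lam t k)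
  have hclean : Clean L U ηc :=
    ⟨hL, hLU, clamp_meas.comp (progMeas_joint hFle hη_prog), fun t ω => clamp_bdd hLU.le _⟩
  have hlc : ∀ k, InS L U (lc k) := fun k =>
    ⟨clamp_meas.comp (hlam_meas k), fun t => clamp_bdd hLU.le _⟩
  have hind : iIndep (fun k => MeasurableSpace.comap (E k) inferInstance) μ :=
    hindep.precomp (Option.some_injective ℕ)
  have hmem : ∀ᵐ t ∂(volume.restrict (Set.Ici (0:ℝ))), (0:ℝ) ≤ t :=
    ae_restrict_mem measurableSet_Ici
  have hη1 : ∀ᵐ ω ∂μ, ∀ᵐ s ∂(volume.restrict (Set.Ici (0:ℝ))), η s ω = ηc s ω := by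
    filter_upwards [Measure.ae_ae_of_ae_prod hη_bdd] with ω hω
    filter_upwards [hω, hmem] with s hs h0
    simp only [ηc]
    rw [max_eq_right h0, clamp_eq hs]
  have hη2 : ∀ᵐ s ∂(volume.restrict (Set.Ici (0:ℝ))), ∀ᵐ ω ∂μ, η s ω = ηc s ω := by
    have hsw : ∀ᵐ p ∂((volume.restrict (Set.Ici (0:ℝ))).prod μ), L ≤ η p.1 p.2 ∧ η p.1 p.2 ≤ U :=
      Measure.measurePreserving_swap.quasiMeasurePreserving.ae hη_bdd
    filter_upwards [Measure.ae_ae_of_ae_prod hsw, hmem] with s hs h0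
    filter_upwards [hs] with ω hω
    simp only [ηc]
    rw [max_eq_right h0, clamp_eq hω]
  have hl1 : ∀ k, ∀ᵐ s ∂(volume.restrict (Set.Ici (0:ℝ))), lam s k = lc k s := by
    intro k
    filter_upwards [hlam_bdd k] with s hs
    exact (clamp_eq hs).symm
  obtain ⟨γ, T, hγS, hT0, hTs, hTp, hfix, huniq⟩ := hclean.sequence hlc hE hind
  -- transfer between the original and the clean data
  have key : ∀ (γ' : ℕ → ℝ → ℝ) (τ : ℕ → Ω → ℝ), (∀ ω, τ 0 ω = 0) →
      (∀ (k : ℕ) (ω : Ω), τ (k + 1) ω = nextTau (E k) η (fun s => lam s k) (γ' k) (τ k) ω) →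
      ∀ k, (∀ j < k, ∀ᵐ t ∂(volume.restrict (Set.Ici (0:ℝ))), γ j t = γ' j t) →
      ∀ᵐ t ∂(volume.restrict (Set.Ici (0:ℝ))),
        Dn μ η (fun s => lam s k) (τ k) (γ' k) t = Dn μ ηc (lc k) (T k) (γ' k) t ∧
        Nn μ η (fun s => lam s k) (τ k) (γ' k) t = Nn μ ηc (lc k) (T k) (γ' k) t := by
    intro γ' τ h0 hs k hj
    have hτ : ∀ᵐ ω ∂μ, τ k ω = T k ω ∧
        ∀ t, J η (fun s => lam s k) (γ' k) (T k ω) t ω = J ηc (lc k) (γ' k) (T k ω) t ω := by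
      filter_upwards [hη1] with ω hω
      constructor
      · refine tau_congr (E := E) (l := fun k s => lam s k) (h0 ω) (hT0 ω) (fun k => hTp k ω)
          (fun k => hs k ω) (fun k => hTs k ω) k ?_
        intro j hjk
        filter_upwards [hω, hl1 j, hj j hjk] with s h1 h2 h3
        rw [h1, h2, h3]
      · intro t
        refine J_congr ?_ (hTp k ω) t
        filter_upwards [hω, hl1 k] with s h1 h2
        rw [h1, h2]
    filter_upwards [hη2] with t ht
    constructor
    · refine integral_congr_ae ?_
      filter_upwards [hτ] with ω hω
      rw [hω.1, hω.2 t]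
    · refine integral_congr_ae ?_
      filter_upwards [hτ, ht] with ω hω h2
      rw [hω.1, hω.2 t, h2]
  refine ⟨γ, fun k => (hγS k).1, fun k t => (hγS k).2 t, ?_, ?_⟩
  · intro τ h0 hs k
    have hpos : ∀ᵐ t ∂(volume.restrict (Set.Ici (0:ℝ))), 0 < t := by
      rw [← restrict_Ioi_eq_restrict_Ici]
      exact ae_restrict_mem measurableSet_Ioi
    filter_upwards [key γ τ h0 hs k (fun j _ => ae_of_all _ fun _ => rfl), hpos] with t ht htp
    change γ k t * Dn μ η (fun s => lam s k) (τ k) (γ k) t =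
      Nn μ η (fun s => lam s k) (τ k) (γ k) t
    rw [ht.1, ht.2]
    exact hfix k t htp
  · intro γ' hm hb hγ'
    let τ : ℕ → Ω → ℝ := fun n => Nat.rec (fun _ => 0)
      (fun k τ => nextTau (E k) η (fun s => lam s k) (γ' k) τ) n
    have hs : ∀ (k : ℕ) (ω : Ω),
        τ (k + 1) ω = nextTau (E k) η (fun s => lam s k) (γ' k) (τ k) ω := fun _ _ => rfl
    have hγ'' := hγ' τ (fun _ => rfl) hs
    intro k
    induction k using Nat.strong_induction_on with
    | _ k ih =>
      refine huniq k (γ' k) ⟨hm k, hb k⟩ ?_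
      filter_upwards [key γ' τ (fun _ => rfl) hs k ih, hγ'' k] with t ht he
      change γ' k t * Dn μ η (fun s => lam s k) (τ k) (γ' k) t =
        Nn μ η (fun s => lam s k) (τ k) (γ' k) t at he
      rwa [ht.1, ht.2] at he

end InvMarkovJump
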